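/- Let Φ = ∃X ∀Y G be a 2-QBF with G = D1 ∨ … ∨ Dh a DNF over X ∪ Y, where Di = L_{i,1} ∧ … ∧ L_{i,k_i}. Define the normal ASP(Q) program Π_Φ = ∃^st P1 ∀^st P2 : C where P1 guesses an arbitrary truth assignment to the atoms in X (via a choice rule over X), P2 guesses an arbitrary truth assignment to the atoms in Y (via a choice rule over Y), and C = { sat ← σ(L_{i,1}),…,σ(L_{i,k_i}) | i = 1,…,h } ∪ { ← not sat }, with σ mapping a positive literal z to z and a negative literal ¬z to the complementary atom nz. Then Π_Φ is coherent if and only if Φ is satisfiable (valid). -/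

import Mathlib

/- ===== Core formalization of propositional ASP and ASP(Q) ===== -/

namespace ASPQ

/-- A ground disjunctive rule `a₁ ∨ … ∨ a_l ← b₁,…,b_m, not c₁,…, not c_n`
(atoms are natural numbers). -/
structure Rule where
  head : Finset ℕ
  pos : Finset ℕ
  neg : Finset ℕ
deriving DecidableEq

/-- A (ground) disjunctive program: a finite set of rules. -/
abbrev Program := Finset Rule

/-- An interpretation: a finite set of atoms. -/
abbrev Interp := Finset ℕ

def Rule.atoms (r : Rule) : Finset ℕ := r.head ∪ r.pos ∪ r.neg

/-- The Herbrand base (set of atoms) of a program. -/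
def atomsOf (P : Program) : Finset ℕ := P.sup Rule.atoms

/-- `I` is a model of rule `r`. -/
def modelsRule (I : Interp) (r : Rule) : Prop :=
  r.pos ⊆ I → r.neg ∩ I = ∅ → (r.head ∩ I).Nonempty

/-- `I` is a model of program `P`. -/
def models (I : Interp) (P : Program) : Prop := ∀ r ∈ P, modelsRule I r

/-- The Gelfond-Lifschitz reduct `P^I`. -/
def reduct (P : Program) (I : Interp) : Program :=
  (P.filter (fun r => r.neg ∩ I = ∅)).image (fun r => ⟨r.head, r.pos, ∅⟩)

/-- The constraints (rules with empty head) of `P`. -/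
def constraintsOf (P : Program) : Program := P.filter (fun r => r.head = ∅)

/-- The non-constraint rules of `P`. -/
def properOf (P : Program) : Program := P.filter (fun r => r.head ≠ ∅)

/-- `I` is a minimal model of `P`. -/
def minModel (I : Interp) (P : Program) : Prop :=
  models I P ∧ ∀ J : Interp, J ⊂ I → ¬ models J P

/-- `I` is an answer set (stable model) of `P`: an answer set of `P` minus its
constraints that is also a model of the constraints of `P`. -/
def answerSet (P : Program) (I : Interp) : Prop :=
  I ⊆ atomsOf P ∧ minModel I (reduct (properOf P) I) ∧ models I (constraintsOf P)

/-- The set of answer sets of `P`. -/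
def AS (P : Program) : Set Interp := {I | answerSet P I}

/-- A program is coherent if it has an answer set. -/
def coherentP (P : Program) : Prop := (AS P).Nonempty

def factRule (a : ℕ) : Rule := ⟨{a}, ∅, ∅⟩
def constrRule (a : ℕ) : Rule := ⟨∅, {a}, ∅⟩

/-- `fix_P(I)`: the facts `a` for `a ∈ I` and constraints `← a` for `a ∈ B_P ∖ I`. -/
def fixProg (P : Program) (I : Interp) : Program :=
  I.image factRule ∪ (atomsOf P \ I).image constrRule

def normalRule (r : Rule) : Prop := r.head.card ≤ 1

/-- A program is normal if each rule has at most one head atom. -/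
def normalProg (P : Program) : Prop := ∀ r ∈ P, normalRule r

/-- A (ground) program is stratified: there is a level mapping of atoms such that
for each rule, positive body atoms have level at most that of each head atom and
negative body atoms have strictly smaller level. -/
def stratifiedProg (P : Program) : Prop :=
  ∃ ℓ : ℕ → ℕ, ∀ r ∈ P, ∀ a ∈ r.head,
    (∀ b ∈ r.pos, ℓ b ≤ ℓ a) ∧ (∀ c ∈ r.neg, ℓ c < ℓ a)

/-- An ASP(Q) program `□₁ P₁ … □ₙ Pₙ : C`; `true` stands for `∃ˢᵗ`, `false` for `∀ˢᵗ`. -/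
structure QProg where
  pre : List (Bool × Program)
  con : Program

/-- Well-formedness of an ASP(Q) program: at least one quantifier, and the
constraint program `C` is a stratified normal program. -/
def wellFormedQ (Φ : QProg) : Prop :=
  Φ.pre ≠ [] ∧ normalProg Φ.con ∧ stratifiedProg Φ.con

/-- A normal ASP(Q) program: each quantified program is normal. -/
def normalQ (Φ : QProg) : Prop := ∀ p ∈ Φ.pre, normalProg p.2

/-- An existential ASP(Q) program: `□₁ = ∃ˢᵗ`. -/
def existentialQ (Φ : QProg) : Prop := ∃ P rest, Φ.pre = (true, P) :: rest

/-- A universal ASP(Q) program: `□₁ = ∀ˢᵗ`. -/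
def universalQ (Φ : QProg) : Prop := ∃ P rest, Φ.pre = (false, P) :: rest

/-- Coherence of the remainder of an ASP(Q) program, where `F` is the `fix`
program contributed by the answer set chosen at the previous level
(`F = ∅` initially): `cohFrom C F [(□₁,P₁),…,(□ₙ,Pₙ)]` means that
`□₁ (P₁ ∪ F) □₂ P₂ … □ₙ Pₙ : C` is coherent. -/
def cohFrom (C : Program) : Program → List (Bool × Program) → Prop
  | F, [] => coherentP (C ∪ F)
  | F, (q, P) :: rest =>
      if q then ∃ M ∈ AS (P ∪ F), cohFrom C (fixProg (P ∪ F) M) rest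
      else ∀ M ∈ AS (P ∪ F), cohFrom C (fixProg (P ∪ F) M) rest

/-- Coherence of an ASP(Q) program. -/
def QProg.coherent (Φ : QProg) : Prop := cohFrom Φ.con ∅ Φ.pre

/-- The quantified answer sets of an (existential) ASP(Q) program. -/
def QProg.QAS (Φ : QProg) : Set Interp :=
  match Φ.pre with
  | [] => ∅
  | (q, P1) :: rest => {M | q = true ∧ M ∈ AS P1 ∧ cohFrom Φ.con (fixProg P1 M) rest}

end ASPQ

/- ===== Quantified Boolean formulas and their encoding into ASP(Q).
A propositional variable `v` is represented by the atom `3*v`, its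
complementary atom `nv` by `3*v+1`, and the auxiliary atom `ok_j` (resp. `sat`)
for the `j`-th clause by `3*j+2`. ===== -/

namespace ASPQ

/-- A literal: a variable together with a sign (`true` = positive). -/
abbrev Lit := ℕ × Bool

/-- The atom `σ(l)` representing literal `l`: `x` for the positive literal on
variable `x`, and the complementary atom `nx` for the negative one. -/
def litAtom (l : Lit) : ℕ := if l.2 then 3 * l.1 else 3 * l.1 + 1

/-- Truth of a literal under an assignment. -/
def litTrue (a : ℕ → Bool) (l : Lit) : Prop := a l.1 = l.2

/-- A 3-clause (or a 3-conjunct): a triple of literals. -/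
abbrev Clause3 := Lit × Lit × Lit

/-- Truth of a 3-CNF under an assignment. -/
def cnfTrue (cls : List Clause3) (a : ℕ → Bool) : Prop :=
  ∀ c ∈ cls, litTrue a c.1 ∨ litTrue a c.2.1 ∨ litTrue a c.2.2

/-- Truth of a 3-DNF under an assignment. -/
def dnfTrue (ds : List Clause3) (a : ℕ → Bool) : Prop :=
  ∃ c ∈ ds, litTrue a c.1 ∧ litTrue a c.2.1 ∧ litTrue a c.2.2

/-- The program `{ x ← not nx ; nx ← not x }` guessing a truth value for
variable `v`. -/
def guessProg (v : ℕ) : Program :=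
  {⟨{3 * v}, ∅, {3 * v + 1}⟩, ⟨{3 * v + 1}, ∅, {3 * v}⟩}

/-- The guessing program for a block `X` of variables. -/
def blockProg (X : Finset ℕ) : Program := X.biUnion guessProg

end ASPQ

namespace ASPQ

/-- The atom `sat` (distinct from every variable atom `3v` and every
complementary atom `3v+1`). -/
def satAtom : ℕ := 2

/-- The constraint program
`C = { sat ← σ(L_{i,1}),…,σ(L_{i,k_i}) | i = 1,…,h } ∪ { ← not sat }`
for a DNF matrix `G = D₁ ∨ … ∨ D_h` with `Dᵢ = L_{i,1} ∧ … ∧ L_{i,k_i}`,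
where `σ` maps a positive literal `z` to the atom `z` and a negative literal
`¬z` to the complementary atom `nz`. -/
def dnfSatProg (mat : List (List Lit)) : Program :=
  (mat.map fun D => (⟨{satAtom}, (D.map litAtom).toFinset, ∅⟩ : Rule)).toFinset
  ∪ {⟨∅, ∅, {satAtom}⟩}

/-- The normal ASP(Q) program `Π_Φ = ∃ˢᵗ P₁ ∀ˢᵗ P₂ : C` associated with the
2-QBF `Φ = ∃X ∀Y G`: `P₁` guesses an arbitrary truth assignment to the atoms in
`X`, `P₂` guesses an arbitrary truth assignment to the atoms in `Y`, and `C` is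
the program above. -/
def twoQbfToQProg (X Y : Finset ℕ) (mat : List (List Lit)) : QProg :=
  ⟨[(true, blockProg X), (false, blockProg Y)], dnfSatProg mat⟩

/-- Validity of the 2-QBF `∃X ∀Y G` with DNF matrix `G`: there is an assignment
such that every assignment agreeing with it outside `Y` satisfies some
disjunct of `G`. -/
def twoQbfValid (Y : Finset ℕ) (mat : List (List Lit)) : Prop :=
  ∃ a : ℕ → Bool, ∀ a' : ℕ → Bool, (∀ v ∉ Y, a' v = a v) →
    ∃ D ∈ mat, ∀ l ∈ D, litTrue a' l

lemma answerSet_iff {P : Program} {I : Interp} :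
    answerSet P I ↔ I ⊆ atomsOf P ∧ models I P ∧
      ∀ J ⊆ I, (∀ r ∈ P, r.head ≠ ∅ → r.neg ∩ I = ∅ → r.pos ⊆ J → (r.head ∩ J).Nonempty) →
        J = I := by
  have reduct_iff (J : Interp) : models J (reduct (properOf P) I) ↔
      ∀ r ∈ P, r.head ≠ ∅ → r.neg ∩ I = ∅ → r.pos ⊆ J → (r.head ∩ J).Nonempty := by
    simp only [models, reduct, properOf, Finset.forall_mem_image, Finset.mem_filter, modelsRule,
      Finset.empty_inter, true_imp_iff, and_imp]
  have models_iff : models I P ↔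
      models I (reduct (properOf P) I) ∧ models I (constraintsOf P) := by
    rw [reduct_iff]
    simp only [models, constraintsOf, Finset.mem_filter, modelsRule]
    refine ⟨fun h => ⟨fun r hr _ h2 h3 => h r hr h3 h2, fun r hr => h r hr.1⟩, ?_⟩
    rintro ⟨h1, h2⟩ r hr
    by_cases hh : r.head = ∅
    · exact h2 r ⟨hr, hh⟩
    · exact fun h3 h4 => h1 r hr hh h4 h3
  rw [answerSet, minModel, models_iff]
  simp only [← reduct_iff]
  constructor
  · rintro ⟨h1, ⟨h2, h3⟩, h4⟩
    exact ⟨h1, ⟨h2, h4⟩, fun J hJ hm => by_contra fun hne => h3 J (hJ.ssubset_of_ne hne) hm⟩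
  · rintro ⟨h1, ⟨h2, h4⟩, h3⟩
    exact ⟨h1, ⟨h2, fun J hJ hm => hJ.ne (h3 J hJ.subset hm)⟩, h4⟩

lemma atomsOf_union (P Q : Program) : atomsOf (P ∪ Q) = atomsOf P ∪ atomsOf Q :=
  Finset.sup_union

lemma atomsOf_fixProg {P : Program} {I : Interp} (hI : I ⊆ atomsOf P) :
    atomsOf (fixProg P I) = atomsOf P := by
  ext a
  simp only [atomsOf, fixProg, Finset.mem_sup, Finset.mem_union, Finset.mem_image]
  constructor
  · rintro ⟨_, ⟨b, hb, rfl⟩ | ⟨b, hb, rfl⟩, h⟩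
    · obtain rfl : a = b := by simpa [Rule.atoms, factRule] using h
      exact Finset.mem_sup.1 (hI hb)
    · obtain rfl : a = b := by simpa [Rule.atoms, constrRule] using h
      exact Finset.mem_sup.1 (Finset.mem_sdiff.1 hb).1
  · intro h
    by_cases ha : a ∈ I
    · exact ⟨_, Or.inl ⟨a, ha, rfl⟩, by simp [Rule.atoms, factRule]⟩
    · exact ⟨_, Or.inr ⟨a, Finset.mem_sdiff.2 ⟨Finset.mem_sup.2 h, ha⟩, rfl⟩,
        by simp [Rule.atoms, constrRule]⟩

lemma mem_atomsOf_blockProg {X : Finset ℕ} {a : ℕ} :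
    a ∈ atomsOf (blockProg X) ↔ ∃ v ∈ X, a = 3 * v ∨ a = 3 * v + 1 := by
  simp only [atomsOf, Finset.mem_sup, blockProg, Finset.mem_biUnion, guessProg, Finset.mem_insert,
    Finset.mem_singleton]
  constructor
  · rintro ⟨_, ⟨v, hv, rfl | rfl⟩, h⟩
    · exact ⟨v, hv, by simpa [Rule.atoms] using h⟩
    · exact ⟨v, hv, by simpa [Rule.atoms, or_comm] using h⟩
  · rintro ⟨v, hv, h⟩
    exact ⟨_, ⟨v, hv, Or.inl rfl⟩, by simpa [Rule.atoms] using h⟩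

lemma forall_mem_fixProg {P : Program} {I : Interp} {p : Rule → Prop} :
    (∀ r ∈ fixProg P I, p r) ↔
      (∀ a ∈ I, p (factRule a)) ∧ ∀ a ∈ atomsOf P, a ∉ I → p (constrRule a) := by
  simp only [fixProg, Finset.mem_union, or_imp, forall_and, Finset.forall_mem_image,
    Finset.mem_sdiff, and_imp]

lemma forall_mem_blockProg {X : Finset ℕ} {p : Rule → Prop} :
    (∀ r ∈ blockProg X, p r) ↔
      ∀ v ∈ X, p ⟨{3 * v}, ∅, {3 * v + 1}⟩ ∧ p ⟨{3 * v + 1}, ∅, {3 * v}⟩ := by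
  simp only [blockProg, Finset.mem_biUnion, guessProg, Finset.mem_insert, Finset.mem_singleton]
  constructor
  · exact fun h v hv => ⟨h _ ⟨v, hv, Or.inl rfl⟩, h _ ⟨v, hv, Or.inr rfl⟩⟩
  · rintro h _ ⟨v, hv, rfl | rfl⟩
    exacts [(h v hv).1, (h v hv).2]

lemma forall_mem_dnfSatProg {mat : List (List Lit)} {p : Rule → Prop} :
    (∀ r ∈ dnfSatProg mat, p r) ↔
      (∀ D ∈ mat, p ⟨{satAtom}, (D.map litAtom).toFinset, ∅⟩) ∧ p ⟨∅, ∅, {satAtom}⟩ := by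
  simp only [dnfSatProg, Finset.mem_union, or_imp, forall_and, List.mem_toFinset,
    List.forall_mem_map, Finset.mem_singleton, forall_eq]

/-- The set of atoms encoding the restriction of the assignment `a` to the variables in `X`. -/
def assignAtoms (a : ℕ → Bool) (X : Finset ℕ) : Interp := X.image fun v => litAtom (v, a v)

lemma litAtom_injective : Function.Injective litAtom := by
  rintro ⟨v, b⟩ ⟨w, c⟩ h
  cases b <;> cases c <;> simp [litAtom] at h ⊢ <;> omega

lemma litAtom_ne_satAtom (l : Lit) : litAtom l ≠ satAtom := by
  unfold litAtom satAtom
  split <;> omega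

lemma litAtom_mem_assignAtoms {a : ℕ → Bool} {X : Finset ℕ} {l : Lit} :
    litAtom l ∈ assignAtoms a X ↔ l.1 ∈ X ∧ litTrue a l := by
  simp only [assignAtoms, Finset.mem_image, litAtom_injective.eq_iff, litTrue]
  constructor
  · rintro ⟨v, hv, rfl⟩
    exact ⟨hv, rfl⟩
  · exact fun h => ⟨l.1, h.1, Prod.ext rfl h.2⟩

lemma pos_mem_assignAtoms {a : ℕ → Bool} {X : Finset ℕ} {v : ℕ} :
    3 * v ∈ assignAtoms a X ↔ v ∈ X ∧ a v = true :=
  litAtom_mem_assignAtoms (l := (v, true))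

lemma neg_mem_assignAtoms {a : ℕ → Bool} {X : Finset ℕ} {v : ℕ} :
    3 * v + 1 ∈ assignAtoms a X ↔ v ∈ X ∧ a v = false :=
  litAtom_mem_assignAtoms (l := (v, false))

lemma assignAtoms_subset (a : ℕ → Bool) (X : Finset ℕ) :
    assignAtoms a X ⊆ atomsOf (blockProg X) := by
  intro b hb
  obtain ⟨v, hv, rfl⟩ := Finset.mem_image.1 hb
  refine mem_atomsOf_blockProg.2 ⟨v, hv, ?_⟩
  cases a v <;> simp [litAtom]

lemma mem_AS_blockProg_union_fixProg {X : Finset ℕ} {Q : Program} {M I : Interp}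
    (hM : M ⊆ atomsOf Q) (hdisj : Disjoint (atomsOf Q) (atomsOf (blockProg X))) :
    I ∈ AS (blockProg X ∪ fixProg Q M) ↔ ∃ a, I = M ∪ assignAtoms a X := by
  have hpos {v} (hv : v ∈ X) : 3 * v ∉ M := fun h =>
    Finset.disjoint_left.1 hdisj (hM h) (mem_atomsOf_blockProg.2 ⟨v, hv, Or.inl rfl⟩)
  have hneg {v} (hv : v ∈ X) : 3 * v + 1 ∉ M := fun h =>
    Finset.disjoint_left.1 hdisj (hM h) (mem_atomsOf_blockProg.2 ⟨v, hv, Or.inr rfl⟩)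
  simp only [AS, Set.mem_ofPred_eq, answerSet_iff, models, Finset.forall_mem_union,
    forall_mem_blockProg, forall_mem_fixProg, atomsOf_union, atomsOf_fixProg hM]
  simp only [modelsRule, factRule, constrRule, Finset.empty_subset, Finset.singleton_inter,
    Finset.empty_inter, Finset.singleton_subset_iff, true_imp_iff, ne_eq,
    Finset.singleton_ne_empty, not_false_eq_true, not_true_eq_false, false_imp_iff,
    implies_true, and_true, imp_false, ite_eq_right_iff, Finset.nonempty_iff_ne_empty, not_not]
  constructor
  · rintro ⟨-, ⟨hblock, hfact, -⟩, hmin⟩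
    refine ⟨fun v => decide (3 * v ∈ I), (hmin _ ?_ ⟨?_, ?_⟩).symm⟩
    · refine Finset.union_subset hfact fun b hb => ?_
      obtain ⟨v, hv, rfl⟩ := Finset.mem_image.1 hb
      by_cases h : 3 * v ∈ I
      · simp [litAtom, h]
      · simpa [litAtom, h] using (hblock v hv).2 h
    · refine fun v hv => ⟨fun h => ?_, fun h => ?_⟩
      · simp [pos_mem_assignAtoms, hv, (hblock v hv).1 h]
      · simp [neg_mem_assignAtoms, hv, h]
    · exact fun b hb => Finset.mem_union_left _ hb
  · rintro ⟨a, rfl⟩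
    refine ⟨?_, ⟨?_, ?_, ?_⟩, ?_⟩
    · rw [Finset.union_comm]
      exact Finset.union_subset_union (assignAtoms_subset a X) hM
    · intro v hv
      cases h : a v <;> simp [pos_mem_assignAtoms, neg_mem_assignAtoms, hv, h]
    · exact fun b hb => Finset.mem_union_left _ hb
    · intro b hb hbM h
      exact Finset.disjoint_left.1 hdisj hb
        (assignAtoms_subset a X ((Finset.mem_union.1 h).resolve_left hbM))
    · rintro J hJ ⟨hblock, hfact⟩
      refine hJ.antisymm (Finset.union_subset hfact fun b hb => ?_)
      obtain ⟨v, hv, rfl⟩ := Finset.mem_image.1 hb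
      cases h : a v
      · exact (hblock v hv).2 (by simp [pos_mem_assignAtoms, h, hpos hv])
      · exact (hblock v hv).1 (by simp [neg_mem_assignAtoms, h, hneg hv])

lemma coherentP_dnfSatProg_union_fixProg {mat : List (List Lit)} {Q : Program} {M : Interp}
    (hM : M ⊆ atomsOf Q) (hsat : satAtom ∉ atomsOf Q) :
    coherentP (dnfSatProg mat ∪ fixProg Q M) ↔ ∃ D ∈ mat, ∀ l ∈ D, litAtom l ∈ M := by
  have hsatM : satAtom ∉ M := fun h => hsat (hM h)
  have hbody (D : List Lit) (J : Interp) :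
      (D.map litAtom).toFinset ⊆ J ↔ ∀ l ∈ D, litAtom l ∈ J := by
    simp only [Finset.subset_iff, List.mem_toFinset, List.forall_mem_map]
  have hsat_mem : satAtom ∈ atomsOf (dnfSatProg mat) :=
    Finset.mem_sup.2 ⟨⟨∅, ∅, {satAtom}⟩, by simp [dnfSatProg], by simp [Rule.atoms]⟩
  simp only [coherentP, Set.Nonempty, AS, Set.mem_ofPred_eq, answerSet_iff, models,
    Finset.forall_mem_union, forall_mem_dnfSatProg, forall_mem_fixProg, atomsOf_union,
    atomsOf_fixProg hM]
  simp only [modelsRule, factRule, constrRule, Finset.empty_subset, Finset.singleton_inter,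
    Finset.empty_inter, Finset.singleton_subset_iff, true_imp_iff, ne_eq, hbody,
    Finset.singleton_ne_empty, not_false_eq_true, not_true_eq_false, false_imp_iff,
    implies_true, and_true, imp_false, ite_eq_right_iff, Finset.nonempty_iff_ne_empty, not_not]
  constructor
  · rintro ⟨I, -, ⟨⟨-, hI⟩, hfact, -⟩, hmin⟩
    by_contra! hno
    have hMI := hmin M hfact ⟨fun D hD h => by grind, fun _ h => h⟩
    grind
  · rintro ⟨D, hD, hDM⟩
    refine ⟨insert satAtom M, ?_, ⟨⟨?_, ?_⟩, ?_, ?_⟩, ?_⟩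
    · exact Finset.insert_subset (Finset.mem_union_left _ hsat_mem)
        (hM.trans Finset.subset_union_right)
    · simp
    · simp
    · exact fun b hb => Finset.mem_insert_of_mem hb
    · grind
    · rintro J hJ ⟨hrule, hfact⟩
      exact hJ.antisymm (Finset.insert_subset
        (by simpa using hrule D hD fun l hl => hfact _ (hDM l hl)) hfact)

/-- For a 2-QBF `Φ = ∃X ∀Y G` with DNF matrix `G` over
`X ∪ Y` (with `X` and `Y` disjoint), the normal ASP(Q) program `Π_Φ` is
coherent iff `Φ` is satisfiable (valid). -/
theorem twoQbf_qprog_correct (X Y : Finset ℕ) (mat : List (List Lit))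
    (hdisj : Disjoint X Y)
    (hvars : ∀ D ∈ mat, ∀ l ∈ D, l.1 ∈ X ∪ Y) :
    (twoQbfToQProg X Y mat).coherent ↔ twoQbfValid Y mat := by
  have hdisj_atoms : Disjoint (atomsOf (blockProg X)) (atomsOf (blockProg Y)) := by
    refine Finset.disjoint_left.2 fun b hb hb' => ?_
    obtain ⟨v, hv, h⟩ := mem_atomsOf_blockProg.1 hb
    obtain ⟨w, hw, h'⟩ := mem_atomsOf_blockProg.1 hb'
    obtain rfl : v = w := by omega
    exact Finset.disjoint_left.1 hdisj hv hw
  have hAS_X (M : Interp) : M ∈ AS (blockProg X) ↔ ∃ a, assignAtoms a X = M := by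
    simpa [fixProg, atomsOf, eq_comm] using
      mem_AS_blockProg_union_fixProg (X := X) (Q := ∅) (I := M) (Finset.empty_subset _)
        (by simp [atomsOf])
  have hcoh (a b : ℕ → Bool) :
      coherentP (dnfSatProg mat ∪ fixProg (blockProg Y ∪ fixProg (blockProg X) (assignAtoms a X))
        (assignAtoms a X ∪ assignAtoms b Y)) ↔
      ∃ D ∈ mat, ∀ l ∈ D, litTrue (fun v => if v ∈ Y then b v else a v) l := by
    have hX := assignAtoms_subset a X
    have hatoms : atomsOf (blockProg Y ∪ fixProg (blockProg X) (assignAtoms a X)) =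
        atomsOf (blockProg Y) ∪ atomsOf (blockProg X) := by
      rw [atomsOf_union, atomsOf_fixProg hX]
    rw [coherentP_dnfSatProg_union_fixProg]
    · refine exists_congr fun D => and_congr_right fun hD => forall₂_congr fun l hl => ?_
      have hl' := hvars D hD l hl
      have hXY : l.1 ∈ X → l.1 ∉ Y := fun h => Finset.disjoint_left.1 hdisj h
      simp only [Finset.mem_union, litAtom_mem_assignAtoms, litTrue] at hl' ⊢
      grind
    · rw [hatoms, Finset.union_comm]
      exact Finset.union_subset_union (assignAtoms_subset b Y) hX
    · simp only [hatoms, Finset.mem_union, mem_atomsOf_blockProg, satAtom]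
      rintro (⟨v, -, h⟩ | ⟨v, -, h⟩) <;> omega
  have hAS_Y (a : ℕ → Bool) (M : Interp) :=
    mem_AS_blockProg_union_fixProg (I := M) (assignAtoms_subset a X) hdisj_atoms
  simp only [QProg.coherent, twoQbfToQProg, cohFrom, if_true, Finset.union_empty, hAS_X,
    exists_exists_eq_and, hAS_Y, Bool.false_eq_true, if_false, forall_exists_index,
    forall_eq_apply_imp_iff, hcoh, twoQbfValid]
  refine exists_congr fun a => ⟨fun h b hb => ?_, fun h b => h _ fun v hv => if_neg hv⟩
  convert h b using 6 with D l hl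
  grind

end ASPQ
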